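/- arXiv:math/0701237 — 4 statements merged into one kernel-verified Lean document; each statement's English description precedes it below -/
import Mathlib

section
/- Let G be a graph on n vertices with girth at least 5 and spectral radius μ. Then μ² ≤ n − 1. -/
/-- `μ` is the largest eigenvalue (spectral radius) of the adjacency matrix of `G`. -/
def IsSpectralRadius {V : Type*} [Fintype V] [DecidableEq V] (G : SimpleGraph V)
    [DecidableRel G.Adj] (μ : ℝ) : Prop :=
  Module.End.HasEigenvalue (Matrix.toLin' (G.adjMatrix ℝ)) μ ∧
    ∀ x : ℝ, Module.End.HasEigenvalue (Matrix.toLin' (G.adjMatrix ℝ)) x → x ≤ μ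

namespace SimpleGraph

variable {V : Type*} {G : SimpleGraph V}

/-- A graph of girth at least five has no triangle. -/
theorem not_adj_of_five_le_egirth (hg : 5 ≤ G.egirth) {a b c : V} (hab : G.Adj a b)
    (hbc : G.Adj b c) : ¬ G.Adj c a := by
  intro hca
  have h := le_egirth.mp hg a (.cons hab (.cons hbc (.cons hca .nil))) (by
    have h1 := hab.ne
    have h2 := hbc.ne
    have h3 := hca.ne
    simp [Walk.cons_isCycle_iff]
    grind)
  simp only [Walk.length_cons, Walk.length_nil] at h
  norm_cast at h

/-- In a graph of girth at least five, two distinct vertices have at most one common neighbor. -/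
theorem eq_of_adj_of_five_le_egirth (hg : 5 ≤ G.egirth) {a b c d : V} (hac : a ≠ c)
    (hab : G.Adj a b) (hbc : G.Adj b c) (had : G.Adj a d) (hdc : G.Adj d c) : b = d := by
  by_contra hbd
  have h := le_egirth.mp hg a (.cons hab (.cons hbc (.cons hdc.symm (.cons had.symm .nil)))) (by
    have h1 := hab.ne
    have h2 := hbc.ne
    have h3 := had.ne
    have h4 := hdc.ne
    simp [Walk.cons_isCycle_iff]
    grind)
  simp only [Walk.length_cons, Walk.length_nil] at h
  norm_cast at h

/-- In a graph of girth at least five, the degrees of the neighbors of a vertex sum to less than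
the number of vertices. -/
theorem sum_degree_neighborFinset_lt_card [Fintype V] [DecidableEq V] [DecidableRel G.Adj]
    (hg : 5 ≤ G.egirth) (v : V) :
    ∑ w ∈ G.neighborFinset v, G.degree w < Fintype.card V := by
  rw [← Finset.card_univ, ← Finset.card_erase_add_one (Finset.mem_univ v), Nat.lt_succ_iff]
  simp_rw [← card_neighborFinset_eq_degree]
  rw [← Finset.card_sigma]
  refine Finset.card_le_card_of_injOn (fun p ↦ if p.2 = v then p.1 else p.2) ?_ ?_
  · rintro ⟨a, b⟩ h
    simp only [Finset.coe_sigma, Set.mem_sigma_iff, Finset.mem_coe, mem_neighborFinset] at h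
    have := h.1.ne
    simp only [Finset.coe_erase, Finset.coe_univ]
    grind
  · rintro ⟨a, b⟩ h ⟨c, d⟩ h' e
    simp only [Finset.coe_sigma, Set.mem_sigma_iff, Finset.mem_coe, mem_neighborFinset] at h h'
    have h1 := not_adj_of_five_le_egirth hg h.1 h.2
    have h2 := not_adj_of_five_le_egirth hg h'.1 h'.2
    obtain ⟨hva, hab⟩ := h
    obtain ⟨hvc, hcd⟩ := h'
    dsimp only at e hva hab hvc hcd h1 h2
    split_ifs at e with hb hd hd
    · subst hb hd e; rfl
    · exact absurd (e ▸ hva.symm) h2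
    · exact absurd (e ▸ hvc.symm) h1
    · subst e
      obtain rfl := eq_of_adj_of_five_le_egirth hg (Ne.symm hb) hva hab hvc hcd
      rfl

/-- The square of an adjacency eigenvalue is at most any common bound on the sums of the degrees
of the neighbors of a vertex. -/
theorem sq_le_of_hasEigenvalue_adjMatrix [Fintype V] [DecidableEq V] [DecidableRel G.Adj]
    {μ c : ℝ} (hμ : Module.End.HasEigenvalue (Matrix.toLin' (G.adjMatrix ℝ)) μ)
    (hc : ∀ v, ((∑ w ∈ G.neighborFinset v, G.degree w : ℕ) : ℝ) ≤ c) : μ ^ 2 ≤ c := by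
  obtain ⟨x, hx⟩ := hμ.exists_hasEigenvector
  have hsum (v : V) : ∑ w ∈ G.neighborFinset v, x w = μ * x v := by
    simpa [adjMatrix_mulVec_apply] using congrFun hx.apply_eq_smul v
  obtain ⟨u, hu⟩ := Function.ne_iff.mp hx.2
  have : Nonempty V := ⟨u⟩
  obtain ⟨v, hv⟩ := Finite.exists_max fun w ↦ |x w|
  have hpos : 0 < |x v| := (abs_pos.mpr hu).trans_le (hv u)
  refine le_of_mul_le_mul_right ?_ hpos
  calc μ ^ 2 * |x v| = |∑ w ∈ G.neighborFinset v, ∑ z ∈ G.neighborFinset w, x z| := by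
        simp_rw [hsum]
        rw [← Finset.mul_sum, hsum, ← mul_assoc, ← sq, abs_mul, abs_sq]
    _ ≤ ∑ w ∈ G.neighborFinset v, ∑ z ∈ G.neighborFinset w, |x z| :=
        (Finset.abs_sum_le_sum_abs _ _).trans
          (Finset.sum_le_sum fun _ _ ↦ Finset.abs_sum_le_sum_abs _ _)
    _ ≤ ∑ w ∈ G.neighborFinset v, ∑ z ∈ G.neighborFinset w, |x v| :=
        Finset.sum_le_sum fun w _ ↦ Finset.sum_le_sum fun z _ ↦ hv z
    _ = ((∑ w ∈ G.neighborFinset v, G.degree w : ℕ) : ℝ) * |x v| := by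
        simp [Finset.sum_mul]
    _ ≤ c * |x v| := by gcongr; exact hc v

/-- Adjacency eigenvalues of a graph without cycles of length three or four, possibly acyclic,
have square at most the number of vertices minus one. -/
theorem sq_le_card_sub_one_of_five_le_egirth [Fintype V] [DecidableEq V] [DecidableRel G.Adj]
    {μ : ℝ} (hμ : Module.End.HasEigenvalue (Matrix.toLin' (G.adjMatrix ℝ)) μ)
    (hg : 5 ≤ G.egirth) : μ ^ 2 ≤ (Fintype.card V : ℝ) - 1 := by
  refine sq_le_of_hasEigenvalue_adjMatrix hμ fun v ↦ le_sub_iff_add_le.mpr ?_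
  exact_mod_cast sum_degree_neighborFinset_lt_card hg v

end SimpleGraph

theorem stmt2 {V : Type*} [Fintype V] [DecidableEq V] (G : SimpleGraph V)
    [DecidableRel G.Adj] (μ : ℝ) (hμ : IsSpectralRadius G μ)
    (hg : 5 ≤ G.girth) :
    μ ^ 2 ≤ (Fintype.card V : ℝ) - 1 := by
  have h : (5 : ℕ∞) ≤ (G.girth : ℕ∞) := by exact_mod_cast hg
  exact SimpleGraph.sq_le_card_sub_one_of_five_le_egirth hμ.1
    (h.trans (ENat.natCast_toNat_le_self _))
end

section
/- Let G be a graph with girth exactly 4, m edges, and spectral radius μ. Then μ² = m if and only if G is a complete bipartite graph K_{a,b} (with a,b ≥ 2 so that a 4-cycle exists), possibly together with isolated vertices. -/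
open Finset in
/-- If no two neighbours of `u` are adjacent, the degrees of the neighbours of `u` count the edges
meeting the neighbourhood of `u`. -/
theorem SimpleGraph.card_biUnion_incidenceFinset_neighborFinset {V : Type*} [Fintype V]
    [DecidableEq V] (G : SimpleGraph V) [DecidableRel G.Adj]
    (htri : ∀ a b c, G.Adj a b → G.Adj a c → ¬ G.Adj b c) (u : V) :
    #((G.neighborFinset u).biUnion fun v ↦ G.incidenceFinset v) =
      ∑ v ∈ G.neighborFinset u, G.degree v := by
  rw [card_biUnion]
  · simp
  · intro a ha b hb hab
    rw [Function.onFun, Finset.disjoint_left]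
    intro e hea heb
    rw [SimpleGraph.mem_incidenceFinset] at hea heb
    rw [mem_coe, SimpleGraph.mem_neighborFinset] at ha hb
    exact htri u a b ha hb (G.adj_of_mem_incidenceSet hab hea heb)

open Finset in
theorem SimpleGraph.biUnion_incidenceFinset_subset_edgeFinset {V : Type*} [Fintype V]
    [DecidableEq V] (G : SimpleGraph V) [DecidableRel G.Adj] (s : Finset V) :
    (s.biUnion fun v ↦ G.incidenceFinset v) ⊆ G.edgeFinset :=
  biUnion_subset.2 fun v _ ↦ G.incidenceFinset_subset v

open Finset in
theorem SimpleGraph.sum_degree_neighborFinset_le {V : Type*} [Fintype V]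
    [DecidableEq V] (G : SimpleGraph V) [DecidableRel G.Adj]
    (htri : ∀ a b c, G.Adj a b → G.Adj a c → ¬ G.Adj b c) (u : V) :
    ∑ v ∈ G.neighborFinset u, G.degree v ≤ #G.edgeFinset := by
  rw [← G.card_biUnion_incidenceFinset_neighborFinset htri]
  exact card_le_card (G.biUnion_incidenceFinset_subset_edgeFinset _)

open Finset in
theorem SimpleGraph.sum_degree_neighborFinset_eq_iff {V : Type*} [Fintype V]
    [DecidableEq V] (G : SimpleGraph V) [DecidableRel G.Adj]
    (htri : ∀ a b c, G.Adj a b → G.Adj a c → ¬ G.Adj b c) (u : V) :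
    ∑ v ∈ G.neighborFinset u, G.degree v = #G.edgeFinset ↔
      ∀ a b, G.Adj a b → G.Adj u a ∨ G.Adj u b := by
  have hsub := G.biUnion_incidenceFinset_subset_edgeFinset (G.neighborFinset u)
  rw [← G.card_biUnion_incidenceFinset_neighborFinset htri]
  constructor
  · intro h a b hab
    have hmem : s(a, b) ∈ G.edgeFinset := by simpa using hab
    rw [← eq_of_subset_of_card_le hsub h.ge, mem_biUnion] at hmem
    obtain ⟨v, hv, hvab⟩ := hmem
    rw [SimpleGraph.mem_neighborFinset] at hv
    rw [SimpleGraph.mem_incidenceFinset] at hvab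
    rcases Sym2.mem_iff.1 hvab.2 with rfl | rfl
    · exact Or.inl hv
    · exact Or.inr hv
  · intro h
    congr 1
    refine hsub.antisymm fun e he ↦ ?_
    induction e with
    | _ a b =>
      have hab : G.Adj a b := by simpa using he
      rw [mem_biUnion]
      rcases h a b hab with h | h
      · exact ⟨a, by simpa using h, by simpa [SimpleGraph.incidenceSet] using hab⟩
      · exact ⟨b, by simpa using h, by simpa [SimpleGraph.incidenceSet] using hab⟩

open Finset in
/-- At a vertex `u` where an adjacency eigenvector is maximal in absolute value, the square of the
eigenvalue is bounded by the sum of the degrees of the neighbours of `u`; if equality holds, the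
eigenvector is also maximal at the end of every walk of length two from `u`. -/
theorem SimpleGraph.sq_eigenvalue_le_sum_degree {V : Type*} [Fintype V]
    [DecidableEq V] (G : SimpleGraph V) [DecidableRel G.Adj] {μ : ℝ} {x : V → ℝ}
    (hx : ∀ v, ∑ w ∈ G.neighborFinset v, x w = μ * x v) {u : V} (hu : ∀ v, |x v| ≤ |x u|)
    (hpos : 0 < |x u|) :
    μ ^ 2 ≤ ∑ v ∈ G.neighborFinset u, (G.degree v : ℝ) ∧
      (∑ v ∈ G.neighborFinset u, (G.degree v : ℝ) ≤ μ ^ 2 →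
        ∀ v w, G.Adj u v → G.Adj v w → |x w| = |x u|) := by
  have hsq : μ ^ 2 * |x u| ≤ ∑ v ∈ G.neighborFinset u, ∑ w ∈ G.neighborFinset v, |x w| :=
    calc μ ^ 2 * |x u| = |∑ v ∈ G.neighborFinset u, ∑ w ∈ G.neighborFinset v, x w| := by
          simp_rw [hx, ← mul_sum, hx]
          rw [← mul_assoc, ← sq, abs_mul, abs_of_nonneg (sq_nonneg μ)]
      _ ≤ _ := (abs_sum_le_sum_abs _ _).trans (sum_le_sum fun v _ ↦ abs_sum_le_sum_abs _ _)
  have hdeg (v : V) : ∑ w ∈ G.neighborFinset v, |x u| = G.degree v * |x u| := by simp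
  have hle (v : V) : ∑ w ∈ G.neighborFinset v, |x w| ≤ G.degree v * |x u| :=
    hdeg v ▸ sum_le_sum fun w _ ↦ hu w
  constructor
  · refine le_of_mul_le_mul_right (hsq.trans ?_) hpos
    rw [sum_mul]
    exact sum_le_sum fun v _ ↦ hle v
  · intro h v w huv hvw
    by_contra hne
    have hlt : ∑ w ∈ G.neighborFinset v, |x w| < G.degree v * |x u| :=
      hdeg v ▸ sum_lt_sum (fun w _ ↦ hu w) ⟨w, by simpa using hvw, (hu w).lt_of_ne hne⟩
    have := hsq.trans_lt (sum_lt_sum (fun v _ ↦ hle v) ⟨v, by simpa using huv, hlt⟩)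
    rw [← sum_mul] at this
    exact (lt_of_mul_lt_mul_right this hpos.le).not_ge h

theorem SimpleGraph.hasEigenvalue_adjMatrix_iff {V : Type*} [Fintype V] [DecidableEq V]
    (G : SimpleGraph V) [DecidableRel G.Adj] {μ : ℝ} :
    Module.End.HasEigenvalue (Matrix.toLin' (G.adjMatrix ℝ)) μ ↔
      ∃ x : V → ℝ, x ≠ 0 ∧ ∀ v, ∑ w ∈ G.neighborFinset v, x w = μ * x v := by
  have key (x : V → ℝ) : Matrix.toLin' (G.adjMatrix ℝ) x = μ • x ↔
      ∀ v, ∑ w ∈ G.neighborFinset v, x w = μ * x v := by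
    simp [funext_iff]
  constructor
  · intro h
    obtain ⟨x, hx⟩ := h.exists_hasEigenvector
    exact ⟨x, hx.2, (key x).1 hx.apply_eq_smul⟩
  · rintro ⟨x, hx0, hx⟩
    exact Module.End.hasEigenvalue_of_hasEigenvector
      ⟨Module.End.mem_eigenspace_iff.2 ((key x).2 hx), hx0⟩

theorem exists_forall_abs_le_of_ne_zero {V : Type*} [Fintype V] {x : V → ℝ} (hx : x ≠ 0) :
    ∃ u, (∀ v, |x v| ≤ |x u|) ∧ 0 < |x u| := by
  obtain ⟨z, hz⟩ := Function.ne_iff.1 hx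
  have : Nonempty V := ⟨z⟩
  obtain ⟨u, hu⟩ := Finite.exists_max fun v ↦ |x v|
  exact ⟨u, hu, (abs_pos.2 hz).trans_le (hu z)⟩

theorem SimpleGraph.not_adj_of_girth_eq_four {V : Type*} {G : SimpleGraph V}
    (hg : G.girth = 4) (a b c : V) (hab : G.Adj a b) (hac : G.Adj a c) : ¬ G.Adj b c := by
  intro hbc
  have hcyc : (Walk.cons hab (Walk.cons hbc (Walk.cons hac.symm Walk.nil))).IsCycle := by
    simp [Walk.isCycle_def, Walk.isTrail_def, hab.ne, hab.ne', hbc.ne, hac.ne, hac.ne']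
  have := hcyc.girth_le_length
  simp [hg] at this

theorem SimpleGraph.exists_four_cycle_of_girth_eq_four {V : Type*} {G : SimpleGraph V}
    (hg : G.girth = 4) :
    ∃ a b c d, a ≠ c ∧ b ≠ d ∧ G.Adj a b ∧ G.Adj b c ∧ G.Adj c d ∧ G.Adj d a := by
  have hac : ¬ G.IsAcyclic := fun h ↦ by simp [h.girth_eq_zero] at hg
  obtain ⟨a, w, hw, hlen⟩ := exists_girth_eq_length.2 hac
  rw [hg] at hlen
  match w, hw, hlen with
  | .cons (v := b) hab (.cons (v := c) hbc (.cons (v := d) hcd (.cons hda .nil))), hw, _ =>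
    have := hw.support_nodup
    simp at this
    exact ⟨a, b, c, d, by grind, by grind, hab, hbc, hcd, hda⟩

open Finset in
theorem exists_complete_bipartite_of_sq_eq {V : Type*} [Fintype V] [DecidableEq V]
    (G : SimpleGraph V) [DecidableRel G.Adj] {μ : ℝ} {x : V → ℝ} (hx0 : x ≠ 0)
    (hx : ∀ v, ∑ w ∈ G.neighborFinset v, x w = μ * x v)
    (htri : ∀ a b c, G.Adj a b → G.Adj a c → ¬ G.Adj b c)
    (hμ : μ ^ 2 = #G.edgeFinset) :
    ∃ s t : Finset V, Disjoint s t ∧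
      ∀ u v : V, G.Adj u v ↔ ((u ∈ s ∧ v ∈ t) ∨ (u ∈ t ∧ v ∈ s)) := by
  obtain ⟨u, hu, hpos⟩ := exists_forall_abs_le_of_ne_zero hx0
  have extremal {w : V} (hw : |x w| = |x u|) :
      (∀ a b, G.Adj a b → G.Adj w a ∨ G.Adj w b) ∧
        ∀ a b, G.Adj w a → G.Adj a b → |x b| = |x w| := by
    obtain ⟨h1, h2⟩ := G.sq_eigenvalue_le_sum_degree hx (hw ▸ hu) (hw ▸ hpos)
    have h3 := G.sum_degree_neighborFinset_le htri w
    refine ⟨(G.sum_degree_neighborFinset_eq_iff htri w).1 (h3.antisymm ?_), h2 ?_⟩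
    · rw [hμ] at h1
      exact_mod_cast h1
    · rw [hμ]
      exact_mod_cast h3
  obtain ⟨hcover, hmax⟩ := extremal rfl
  have hfull (v a w : V) (hv : G.Adj u v) (ha : G.Adj u a) (haw : G.Adj a w) : G.Adj w v :=
    ((extremal (hmax a w ha haw)).1 u v hv).resolve_left
      fun hwu ↦ htri u a w ha hwu.symm haw
  refine ⟨G.neighborFinset u, (G.neighborFinset u).biUnion fun v ↦ G.neighborFinset v, ?_, ?_⟩
  · rw [Finset.disjoint_left]
    intro w hw hw'
    simp only [mem_biUnion, SimpleGraph.mem_neighborFinset] at hw hw'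
    obtain ⟨a, ha, haw⟩ := hw'
    exact htri u a w ha hw haw
  · intro a b
    simp only [mem_biUnion, SimpleGraph.mem_neighborFinset]
    constructor
    · intro hab
      rcases hcover a b hab with h | h
      · exact Or.inl ⟨h, a, h, hab⟩
      · exact Or.inr ⟨⟨b, h, hab.symm⟩, h⟩
    · rintro (⟨ha, c, hc, hcb⟩ | ⟨⟨c, hc, hca⟩, hb⟩)
      · exact (hfull a c b ha hc hcb).symm
      · exact hfull b c a hb hc hca

open Finset in
theorem IsSpectralRadius.sq_eq_of_complete_bipartite {V : Type*} [Fintype V] [DecidableEq V]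
    {G : SimpleGraph V} [DecidableRel G.Adj] {μ : ℝ} (hμ : IsSpectralRadius G μ)
    (htri : ∀ a b c, G.Adj a b → G.Adj a c → ¬ G.Adj b c) {s t : Finset V} (hst : Disjoint s t)
    (hs : s.Nonempty)
    (hG : ∀ u v : V, G.Adj u v ↔ ((u ∈ s ∧ v ∈ t) ∨ (u ∈ t ∧ v ∈ s))) :
    μ ^ 2 = #G.edgeFinset := by
  have hns {v : V} (hv : v ∈ s) : G.neighborFinset v = t := by
    ext w
    simp [hG, hv, Finset.disjoint_left.1 hst hv]
  have hnt {v : V} (hv : v ∈ t) : G.neighborFinset v = s := by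
    ext w
    simp [hG, hv, Finset.disjoint_right.1 hst hv]
  have hn {v : V} (hvs : v ∉ s) (hvt : v ∉ t) : G.neighborFinset v = ∅ := by
    ext w
    simp [hG, hvs, hvt]
  obtain ⟨u, hu⟩ := hs
  have hedge : #G.edgeFinset = #t * #s := by
    rw [← (G.sum_degree_neighborFinset_eq_iff htri u).2, hns hu,
      sum_congr rfl fun v hv ↦ by rw [← G.card_neighborFinset_eq_degree, hnt hv]]
    · simp
    · intro a b hab
      rw [hG] at hab
      rcases hab with ⟨_, hb⟩ | ⟨ha, _⟩
      · exact Or.inr ((hG u b).2 (Or.inl ⟨hu, hb⟩))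
      · exact Or.inl ((hG u a).2 (Or.inl ⟨hu, ha⟩))
  refine le_antisymm ?_ ?_
  · obtain ⟨x, hx0, hx⟩ := G.hasEigenvalue_adjMatrix_iff.1 hμ.1
    obtain ⟨z, hz, hpos⟩ := exists_forall_abs_le_of_ne_zero hx0
    exact (G.sq_eigenvalue_le_sum_degree hx hz hpos).1.trans
      (by exact_mod_cast G.sum_degree_neighborFinset_le htri z)
  · rw [hedge]
    by_cases ht : #t = 0
    · simpa [ht] using sq_nonneg μ
    have htpos : 0 < √(#t : ℝ) := Real.sqrt_pos.2 (by exact_mod_cast Nat.pos_of_ne_zero ht)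
    have hle : √(#t : ℝ) * √(#s : ℝ) ≤ μ := by
      refine hμ.2 _ (G.hasEigenvalue_adjMatrix_iff.2
        ⟨fun v ↦ if v ∈ s then √(#t : ℝ) else if v ∈ t then √(#s : ℝ) else 0, ?_, ?_⟩)
      · intro h
        have := congrFun h u
        simp only [hu, if_true, Pi.zero_apply] at this
        exact htpos.ne' this
      · have hss : √(#s : ℝ) * √(#s : ℝ) = #s := Real.mul_self_sqrt (Nat.cast_nonneg _)
        have htt : √(#t : ℝ) * √(#t : ℝ) = #t := Real.mul_self_sqrt (Nat.cast_nonneg _)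
        intro v
        by_cases hvs : v ∈ s
        · rw [hns hvs, sum_eq_card_nsmul (b := √(#s : ℝ)) fun w hw ↦ by
            simp [hw, Finset.disjoint_right.1 hst hw]]
          simp only [hvs, if_true, nsmul_eq_mul]
          linear_combination -√(#s : ℝ) * htt
        · by_cases hvt : v ∈ t
          · rw [hnt hvt, sum_eq_card_nsmul (b := √(#t : ℝ)) fun w hw ↦ by simp [hw]]
            simp only [hvs, hvt, if_true, if_false, nsmul_eq_mul]
            linear_combination -√(#t : ℝ) * hss
          · simp [hn hvs hvt, hvs, hvt]
    calc ((#t * #s : ℕ) : ℝ) = (√(#t : ℝ) * √(#s : ℝ)) ^ 2 := by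
          rw [mul_pow, Real.sq_sqrt (Nat.cast_nonneg _), Real.sq_sqrt (Nat.cast_nonneg _)]
          push_cast
          rfl
      _ ≤ μ ^ 2 := pow_le_pow_left₀ (by positivity) hle 2

theorem stmt3 {V : Type*} [Fintype V] [DecidableEq V] (G : SimpleGraph V)
    [DecidableRel G.Adj] (μ : ℝ) (hμ : IsSpectralRadius G μ)
    (hg : G.girth = 4) :
    μ ^ 2 = (G.edgeFinset.card : ℝ) ↔
      ∃ s t : Finset V, Disjoint s t ∧ 2 ≤ s.card ∧ 2 ≤ t.card ∧
        ∀ u v : V, G.Adj u v ↔ ((u ∈ s ∧ v ∈ t) ∨ (u ∈ t ∧ v ∈ s)) := by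
  have htri := SimpleGraph.not_adj_of_girth_eq_four hg
  constructor
  · intro h
    obtain ⟨x, hx0, hx⟩ := G.hasEigenvalue_adjMatrix_iff.1 hμ.1
    obtain ⟨s, t, hst, hG⟩ := exists_complete_bipartite_of_sq_eq G hx0 hx htri h
    obtain ⟨a, b, c, d, hac, hbd, hab, hbc, hcd, hda⟩ :=
      SimpleGraph.exists_four_cycle_of_girth_eq_four hg
    have hst' := Finset.disjoint_left.1 hst
    rw [hG] at hab hbc hcd hda
    refine ⟨s, t, hst, ?_, ?_, hG⟩ <;> rw [← Nat.lt_iff_add_one_le, Finset.one_lt_card] <;> grind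
  · rintro ⟨s, t, hst, hs, -, hG⟩
    exact hμ.sq_eq_of_complete_bipartite htri hst (Finset.card_pos.1 (by lia)) hG
end

section
/- Every graph with girth at least 5 and average degree d has at least d² + 1 vertices. -/
namespace SimpleGraph

variable {V : Type*} {G : SimpleGraph V}

/-- A graph of girth at least four has no triangles. -/
lemma not_adj_of_four_le_girth (hg : 4 ≤ G.girth) {a b c : V} (hab : G.Adj a b)
    (hbc : G.Adj b c) : ¬ G.Adj c a := by
  intro hca
  have hcyc : (Walk.cons hab (.cons hbc (.cons hca .nil))).IsCycle := by
    simp [Walk.cons_isCycle_iff, Walk.cons_isPath_iff, hab.ne, hbc.ne, hca.ne, hab.ne', hca.ne']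
  have := hcyc.girth_le_length
  simp at this
  omega

/-- In a graph of girth at least five, two distinct vertices have at most one common neighbor. -/
lemma eq_of_adj_of_five_le_girth (hg : 5 ≤ G.girth) {a b c d : V} (hac : a ≠ c)
    (hab : G.Adj a b) (hbc : G.Adj b c) (had : G.Adj a d) (hdc : G.Adj d c) : b = d := by
  by_contra hbd
  have hcyc : (Walk.cons hab (.cons hbc (.cons hdc.symm (.cons had.symm .nil)))).IsCycle := by
    simp [Walk.cons_isCycle_iff, Walk.cons_isPath_iff, hab.ne, hbc.ne, hdc.ne', had.ne', hab.ne',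
      hac, hac.symm, hbd, had.ne]
  have := hcyc.girth_le_length
  simp at this
  omega

variable [Fintype V] [DecidableRel G.Adj]

/-- In a graph of girth at least five, walks of length two starting at `v` inject into the
vertices other than `v`: send `v, w, u` to `u` if `u ≠ v`, and to `w` otherwise. -/
lemma sum_degree_neighborFinset_le_of_five_le_girth [DecidableEq V] (hg : 5 ≤ G.girth)
    (v : V) :
    ∑ w ∈ G.neighborFinset v, G.degree w ≤ Fintype.card V - 1 := by
  simp_rw [← card_neighborFinset_eq_degree]
  rw [← Finset.card_sigma, ← Finset.card_univ, ← Finset.card_erase_of_mem (Finset.mem_univ v)]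
  refine Finset.card_le_card_of_injOn (fun p => if p.2 = v then p.1 else p.2) ?_ ?_
  · rintro ⟨w, u⟩ h
    simp only [Finset.coe_sigma, Set.mem_sigma_iff, Finset.mem_coe, mem_neighborFinset] at h
    by_cases hu : u = v
    · simp [hu, h.1.ne']
    · simp [hu]
  · rintro ⟨w, u⟩ h ⟨w', u'⟩ h' heq
    simp only [Finset.coe_sigma, Set.mem_sigma_iff, Finset.mem_coe, mem_neighborFinset] at h h'
    dsimp only at heq
    split_ifs at heq with hu hu' hu'
    · subst heq hu hu'
      rfl
    · subst heq
      exact absurd h.1.symm (not_adj_of_four_le_girth (by omega) h'.1 h'.2)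
    · subst heq
      exact absurd h'.1.symm (not_adj_of_four_le_girth (by omega) h.1 h.2)
    · subst heq
      rw [eq_of_adj_of_five_le_girth hg (Ne.symm hu) h.1 h.2 h'.1 h'.2]

lemma sum_sum_degree_neighborFinset :
    ∑ v, ∑ w ∈ G.neighborFinset v, G.degree w = ∑ w, G.degree w ^ 2 := by
  rw [Finset.sum_comm' (t' := Finset.univ) (s' := fun w => G.neighborFinset w)
    (by simp [adj_comm])]
  simp [sq]

lemma sum_sq_degree_le_of_five_le_girth [DecidableEq V] (hg : 5 ≤ G.girth) :
    ∑ v, G.degree v ^ 2 ≤ Fintype.card V * (Fintype.card V - 1) := by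
  rw [← sum_sum_degree_neighborFinset]
  simpa using Finset.sum_le_sum fun v (_ : v ∈ Finset.univ) =>
    sum_degree_neighborFinset_le_of_five_le_girth hg v

end SimpleGraph

theorem stmt17 {V : Type*} [Fintype V] [DecidableEq V] [Nonempty V]
    (G : SimpleGraph V) [DecidableRel G.Adj] (hg : 5 ≤ G.girth) (d : ℝ)
    (hd : d = 2 * (G.edgeFinset.card : ℝ) / (Fintype.card V : ℝ)) :
    d ^ 2 + 1 ≤ (Fintype.card V : ℝ) := by
  have hn : 0 < Fintype.card V := Fintype.card_pos
  have hcs : (∑ v, (G.degree v : ℝ)) ^ 2 ≤ Fintype.card V * ∑ v, (G.degree v : ℝ) ^ 2 := by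
    simpa using sq_sum_le_card_mul_sum_sq (s := Finset.univ) (f := fun v => (G.degree v : ℝ))
  have hsum : ∑ v, (G.degree v : ℝ) = 2 * G.edgeFinset.card := by
    exact_mod_cast G.sum_degrees_eq_twice_card_edges
  have hsq : ∑ v, (G.degree v : ℝ) ^ 2 ≤ Fintype.card V * ((Fintype.card V : ℝ) - 1) := by
    have h := SimpleGraph.sum_sq_degree_le_of_five_le_girth hg
    rw [← Nat.cast_le (α := ℝ)] at h
    push_cast [Nat.cast_sub hn] at h
    exact h
  have hn' : (0 : ℝ) < Fintype.card V := by exact_mod_cast hn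
  rw [← le_sub_iff_add_le, hd, div_pow, div_le_iff₀ (by positivity), ← hsum]
  calc _ ≤ _ := hcs
    _ ≤ Fintype.card V * (Fintype.card V * ((Fintype.card V : ℝ) - 1)) := by gcongr
    _ = _ := by ring
end

section
/- Every graph with girth at least 2r+1 and average degree d ≥ 2 has at least 1 + d + d(d−1) + ⋯ + d(d−1)^{r−1} vertices. -/
namespace SimpleGraph

open Finset

variable {V : Type*} {G : SimpleGraph V}

/-- A non-backtracking walk that is short compared to the girth is determined by its ends. -/
theorem Walk.eq_of_isChain_edges_of_length_add_length_lt_egirth {u v : V} {p q : G.Walk u v}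
    (hp : p.edges.IsChain (· ≠ ·)) (hq : q.edges.IsChain (· ≠ ·))
    (h : ((p.length + q.length : ℕ) : ℕ∞) < G.egirth) : p = q := by
  classical
  set s : Finset (Sym2 V) := (p.edges ++ q.edges).toFinset with hs
  set H : SimpleGraph V := fromEdgeSet (s : Set (Sym2 V)) with hH
  have hsG : ∀ e ∈ s, e ∈ G.edgeSet := by
    intro e he
    rw [hs, List.mem_toFinset, List.mem_append] at he
    exact he.elim (fun h ↦ p.edges_subset_edgeSet h) (fun h ↦ q.edges_subset_edgeSet h)
  have hsH : ∀ e ∈ s, e ∈ H.edgeSet := by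
    intro e he
    rw [hH, edgeSet_fromEdgeSet]
    exact ⟨he, G.not_isDiag_of_mem_edgeSet (hsG e he)⟩
  have hHs : ∀ e ∈ H.edgeSet, e ∈ s := by
    intro e he
    rw [hH, edgeSet_fromEdgeSet] at he
    exact he.1
  have hacyc : H.IsAcyclic := by
    intro a c hc
    have hcG : ∀ e ∈ c.edges, e ∈ G.edgeSet :=
      fun e he ↦ hsG e (hHs e (c.edges_subset_edgeSet he))
    have h1 := egirth_le_length (hc.transfer hcG)
    rw [Walk.length_transfer] at h1
    have h2 : c.length ≤ p.length + q.length := by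
      calc c.length = c.edges.toFinset.card := by
            rw [List.toFinset_card_of_nodup hc.edges_nodup, Walk.length_edges]
        _ ≤ s.card := card_le_card fun e he ↦
            hHs e (c.edges_subset_edgeSet (List.mem_toFinset.1 he))
        _ ≤ (p.edges ++ q.edges).length := List.toFinset_card_le _
        _ = p.length + q.length := by simp
    exact absurd (h1.trans (by exact_mod_cast h2)) (not_le.2 h)
  have hpH : ∀ e ∈ p.edges, e ∈ H.edgeSet := fun e he ↦ hsH e (by simp [hs, he])
  have hqH : ∀ e ∈ q.edges, e ∈ H.edgeSet := fun e he ↦ hsH e (by simp [hs, he])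
  have hp' : (p.transfer H hpH).IsPath :=
    (hacyc.isPath_iff_isChain _).2 (by rwa [Walk.edges_transfer])
  have hq' : (q.transfer H hqH).IsPath :=
    (hacyc.isPath_iff_isChain _).2 (by rwa [Walk.edges_transfer])
  have heq := congrArg (fun w : H.Path u v ↦ (w : H.Walk u v).support)
    ((hacyc.subsingleton_path u v).elim ⟨_, hp'⟩ ⟨_, hq'⟩)
  simp only [Walk.support_transfer] at heq
  exact Walk.ext_support heq

variable [Fintype V] [DecidableEq V] [DecidableRel G.Adj]

namespace Dart

/-- The darts that can follow `e` in a non-backtracking walk. -/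
def next (e : G.Dart) : Finset G.Dart := {f | f.fst = e.snd ∧ f ≠ e.symm}

theorem mem_next {e f : G.Dart} : f ∈ e.next ↔ f.fst = e.snd ∧ f ≠ e.symm := by
  simp [next]

theorem symm_mem_next_symm {e f : G.Dart} : e.symm ∈ f.symm.next ↔ f ∈ e.next := by
  rw [mem_next, mem_next, symm_symm, Ne, Ne, eq_comm (a := f)]
  exact and_congr_left fun _ ↦ eq_comm

theorem edge_ne_of_mem_next {e f : G.Dart} (h : f ∈ e.next) : e.edge ≠ f.edge := by
  rw [mem_next] at h
  rw [Ne, dart_edge_eq_iff]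
  rintro (rfl | rfl)
  · exact e.fst_ne_snd h.1
  · simp at h

theorem card_next_add_one (e : G.Dart) : #e.next + 1 = G.degree e.snd := by
  rw [← G.dart_fst_fiber_card_eq_degree]
  have : e.next = ({f | f.fst = e.snd} : Finset G.Dart).erase e.symm := by
    ext f
    simp [mem_next, and_comm]
  rw [this, card_erase_add_one]
  simp

/-- The number of non-backtracking walks of length `k + 1` whose first dart is `e`. -/
def nonbacktrackingCount : ℕ → G.Dart → ℕ
  | 0, _ => 1
  | k + 1, e => ∑ f ∈ e.next, nonbacktrackingCount k f

/-- The ends of the non-backtracking walks of length `k + 1` whose first dart is `e`. -/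
def nonbacktrackingEnds : ℕ → G.Dart → Finset V
  | 0, e => {e.snd}
  | k + 1, e => e.next.biUnion (nonbacktrackingEnds k)

theorem exists_walk_of_mem_nonbacktrackingEnds {k : ℕ} {e : G.Dart} {v : V}
    (h : v ∈ e.nonbacktrackingEnds k) : ∃ p : G.Walk e.fst v,
      p.length = k + 1 ∧ p.edges.IsChain (· ≠ ·) ∧ p.darts.head? = some e := by
  induction k generalizing e with
  | zero =>
    obtain rfl : v = e.snd := by simpa [nonbacktrackingEnds] using h
    exact ⟨e.adj.toWalk, by simp⟩
  | succ k ih =>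
    obtain ⟨f, hf, hv⟩ := mem_biUnion.1 h
    obtain ⟨p, hlen, hchain, hhead⟩ := ih hv
    refine ⟨.cons e.adj (p.copy (mem_next.1 hf).1 rfl), by simp [hlen], ?_, rfl⟩
    have hedges : p.edges.head? = some f.edge := by
      rw [Walk.edges, List.head?_map, hhead]
      rfl
    rw [Walk.edges_cons, Walk.edges_copy, List.isChain_cons]
    refine ⟨fun y hy ↦ ?_, hchain⟩
    obtain rfl : f.edge = y := by simpa [hedges] using hy
    exact edge_ne_of_mem_next hf

theorem eq_of_mem_nonbacktrackingEnds {r k l : ℕ} (hr : ((2 * r + 1 : ℕ) : ℕ∞) ≤ G.egirth)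
    (hk : k < r) (hl : l < r) {e f : G.Dart} (hef : e.fst = f.fst) {v : V}
    (he : v ∈ e.nonbacktrackingEnds k) (hf : v ∈ f.nonbacktrackingEnds l) : k = l ∧ e = f := by
  obtain ⟨p, hp, hpc, hpd⟩ := exists_walk_of_mem_nonbacktrackingEnds he
  obtain ⟨q, hq, hqc, hqd⟩ := exists_walk_of_mem_nonbacktrackingEnds hf
  have h : p.copy hef rfl = q := by
    refine Walk.eq_of_isChain_edges_of_length_add_length_lt_egirth (by simpa) hqc ?_
    refine lt_of_lt_of_le ?_ hr
    rw [Walk.length_copy, hp, hq]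
    exact_mod_cast (by omega)
  constructor
  · have := congrArg Walk.length h
    rw [Walk.length_copy] at this
    omega
  · have := congrArg (fun w ↦ w.darts.head?) h
    simpa [hpd, hqd] using this

theorem ne_of_mem_nonbacktrackingEnds {r k : ℕ} (hr : ((2 * r + 1 : ℕ) : ℕ∞) ≤ G.egirth)
    (hk : k < r) {e : G.Dart} {v : V} (he : v ∈ e.nonbacktrackingEnds k) : v ≠ e.fst := by
  rintro rfl
  obtain ⟨p, hp, hpc, -⟩ := exists_walk_of_mem_nonbacktrackingEnds he
  have h : p = .nil := by
    refine Walk.eq_of_isChain_edges_of_length_add_length_lt_egirth hpc (by simp) ?_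
    refine lt_of_lt_of_le ?_ hr
    rw [hp, Walk.length_nil]
    exact_mod_cast (by omega)
  simp [h] at hp

theorem card_nonbacktrackingEnds {r k : ℕ} (hr : ((2 * r + 1 : ℕ) : ℕ∞) ≤ G.egirth)
    (hk : k < r) (e : G.Dart) : #(e.nonbacktrackingEnds k) = e.nonbacktrackingCount k := by
  induction k generalizing e with
  | zero => simp [nonbacktrackingEnds, nonbacktrackingCount]
  | succ k ih =>
    rw [nonbacktrackingEnds, nonbacktrackingCount, card_biUnion]
    · exact sum_congr rfl fun f _ ↦ ih (by omega) f
    · intro f hf f' hf' hne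
      refine Finset.disjoint_left.2 fun v hv hv' ↦ hne ?_
      exact (eq_of_mem_nonbacktrackingEnds hr (by omega) (by omega)
        ((mem_next.1 hf).1.trans (mem_next.1 hf').1.symm) hv hv').2

theorem one_le_card_next (hdeg : ∀ v, 2 ≤ G.degree v) (e : G.Dart) : 1 ≤ #e.next := by
  have := e.card_next_add_one
  have := hdeg e.snd
  omega

theorem nonbacktrackingCount_pos (hdeg : ∀ v, 2 ≤ G.degree v) (k : ℕ) (e : G.Dart) :
    0 < e.nonbacktrackingCount k := by
  induction k generalizing e with
  | zero => exact one_pos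
  | succ k ih => exact sum_pos (fun f _ ↦ ih f) (card_pos.1 (one_le_card_next hdeg e))

end Dart

open Dart

theorem one_add_sum_nonbacktrackingCount_le_card {r : ℕ}
    (hr : ((2 * r + 1 : ℕ) : ℕ∞) ≤ G.egirth) (v : V) :
    1 + ∑ k ∈ range r, ∑ e : G.Dart with e.fst = v, e.nonbacktrackingCount k
      ≤ Fintype.card V := by
  set B : Finset V := (range r ×ˢ ({e | e.fst = v} : Finset G.Dart)).biUnion
    fun x ↦ x.2.nonbacktrackingEnds x.1 with hB
  have hcard : #B = ∑ k ∈ range r, ∑ e : G.Dart with e.fst = v, e.nonbacktrackingCount k := by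
    rw [hB, card_biUnion, sum_product]
    · exact sum_congr rfl fun k hk ↦ sum_congr rfl fun e _ ↦
        card_nonbacktrackingEnds hr (mem_range.1 hk) e
    · rintro ⟨k, e⟩ hx ⟨l, f⟩ hy hne
      simp only [coe_product, Set.mem_prod, mem_coe, mem_range, mem_filter, mem_univ, true_and]
        at hx hy
      refine Finset.disjoint_left.2 fun w hw hw' ↦ hne ?_
      obtain ⟨rfl, rfl⟩ := eq_of_mem_nonbacktrackingEnds hr hx.1 hy.1 (hx.2.trans hy.2.symm) hw hw'
      rfl
  have hv : v ∉ B := by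
    simp only [hB, mem_biUnion, mem_product, mem_range, mem_filter, mem_univ, true_and, not_exists,
      not_and]
    rintro ⟨k, e⟩ ⟨hk, rfl⟩ hmem
    exact ne_of_mem_nonbacktrackingEnds hr hk hmem rfl
  rw [← hcard, add_comm, ← card_insert_of_notMem hv]
  exact card_le_univ _

theorem sum_dart_snd (g : V → ℝ) : ∑ e : G.Dart, g e.snd = ∑ v, G.degree v * g v := by
  calc ∑ e : G.Dart, g e.snd = ∑ e : G.Dart, g e.fst :=
        Fintype.sum_equiv symm_involutive.toPerm _ _ fun _ ↦ rfl
    _ = ∑ v, ∑ e : G.Dart with e.fst = v, g e.fst := (sum_fiberwise _ _ _).symm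
    _ = _ := by
      refine sum_congr rfl fun v _ ↦ ?_
      rw [sum_congr rfl fun e he ↦ congrArg g (mem_filter.1 he).2, sum_const,
        dart_fst_fiber_card_eq_degree, nsmul_eq_mul]

theorem sum_sum_next_div_card_next (hdeg : ∀ v, 2 ≤ G.degree v) (g : G.Dart → ℝ) :
    ∑ e : G.Dart, (∑ f ∈ e.next, g f) / #e.next = ∑ f, g f := by
  have hcard (e f : G.Dart) (h : f ∈ e.next) : #e.next = #f.symm.next := by
    have h1 := e.card_next_add_one
    have h2 := f.symm.card_next_add_one
    rw [← (mem_next.1 h).1] at h1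
    exact Nat.add_right_cancel (h1.trans h2.symm)
  calc ∑ e : G.Dart, (∑ f ∈ e.next, g f) / #e.next
      = ∑ e : G.Dart, ∑ f ∈ e.next, g f / #f.symm.next := by
        refine sum_congr rfl fun e _ ↦ ?_
        rw [sum_div]
        exact sum_congr rfl fun f hf ↦ by rw [hcard e f hf]
    _ = ∑ f : G.Dart, ∑ e ∈ f.symm.next, g f / #f.symm.next := by
        simp_rw [sum_sigma']
        refine sum_bij' (fun x _ ↦ ⟨x.2, x.1.symm⟩) (fun x _ ↦ ⟨x.2.symm, x.1⟩) ?_ ?_ ?_ ?_ ?_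
        · rintro ⟨e, f⟩ h
          simpa [symm_mem_next_symm] using h
        · rintro ⟨f, e⟩ h
          simpa [← symm_mem_next_symm (e := e.symm)] using h
        all_goals simp
    _ = ∑ f, g f := by
        refine sum_congr rfl fun f _ ↦ ?_
        have : (#f.symm.next : ℝ) ≠ 0 := by
          exact_mod_cast Nat.one_le_iff_ne_zero.1 (one_le_card_next hdeg f.symm)
        rw [sum_const, nsmul_eq_mul, mul_div_cancel₀ _ this]

end SimpleGraph

theorem Real.sum_log_div_card_le_log {ι : Type*} {s : Finset ι} (hs : s.Nonempty) {x : ι → ℝ}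
    (hx : ∀ i ∈ s, 0 < x i) : (∑ i ∈ s, log (x i)) / s.card ≤ log ((∑ i ∈ s, x i) / s.card) := by
  have hc : (s.card : ℝ) ≠ 0 := by exact_mod_cast hs.card_pos.ne'
  have := strictConcaveOn_log_Ioi.concaveOn.le_map_sum (t := s) (w := fun _ ↦ (s.card : ℝ)⁻¹)
    (p := x) (fun _ _ ↦ by positivity) (by simp [hc]) hx
  simpa [← Finset.mul_sum, div_eq_inv_mul] using this

theorem convexOn_mul_log_sub_one : ConvexOn ℝ (Set.Ici 2) fun x : ℝ ↦ x * Real.log (x - 1) := by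
  refine convexOn_of_hasDerivWithinAt2_nonneg (convex_Ici 2)
    (f' := fun x ↦ Real.log (x - 1) + x * (1 / (x - 1)))
    (f'' := fun x ↦ (x - 2) / (x - 1) ^ 2) ?_ ?_ ?_ ?_
  · refine continuousOn_id.mul (ContinuousOn.log (by fun_prop) fun x hx ↦ ?_)
    have : (2 : ℝ) ≤ x := hx
    linarith
  all_goals
    intro x hx
    rw [interior_Ici] at hx
    have hx : (2 : ℝ) < x := hx
    have hx1 : x - 1 ≠ 0 := by linarith
  · have h := (hasDerivAt_id x).mul (((hasDerivAt_id x).sub_const 1).log hx1)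
    refine (h.congr_deriv ?_).hasDerivWithinAt
    simp
  · have h1 := ((hasDerivAt_id x).sub_const 1).log hx1
    have h2 := (hasDerivAt_id x).mul (((hasDerivAt_const x (1 : ℝ))).div
      ((hasDerivAt_id x).sub_const 1) hx1)
    refine ((h1.add h2).congr_deriv ?_).hasDerivWithinAt
    simp only [id, Pi.div_apply]
    field_simp
    ring
  · have : 0 ≤ x - 2 := by linarith
    positivity

namespace SimpleGraph

open Finset Dart

variable {V : Type*} [Fintype V] [DecidableEq V] {G : SimpleGraph V} [DecidableRel G.Adj]

theorem mul_sum_log_card_next_le (hdeg : ∀ v, 2 ≤ G.degree v) (k : ℕ) :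
    k * ∑ e : G.Dart, Real.log #e.next
      ≤ ∑ e : G.Dart, Real.log (e.nonbacktrackingCount k) := by
  induction k with
  | zero => simp [nonbacktrackingCount]
  | succ k ih =>
    have key (e : G.Dart) : Real.log #e.next
        + (∑ f ∈ e.next, Real.log (f.nonbacktrackingCount k)) / #e.next
          ≤ Real.log (e.nonbacktrackingCount (k + 1)) := by
      have hne := card_pos.1 (one_le_card_next hdeg e)
      have hc : (0 : ℝ) < #e.next := by exact_mod_cast hne.card_pos
      have hpos : ∀ f ∈ e.next, (0 : ℝ) < f.nonbacktrackingCount k :=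
        fun f _ ↦ by exact_mod_cast nonbacktrackingCount_pos hdeg k f
      have hS := sum_pos hpos hne
      have h := Real.sum_log_div_card_le_log hne hpos
      rw [Real.log_div hS.ne' hc.ne'] at h
      rw [nonbacktrackingCount]
      push_cast
      linarith
    have h := sum_le_sum fun e (_ : e ∈ univ) ↦ key e
    rw [sum_add_distrib, sum_sum_next_div_card_next hdeg] at h
    push_cast
    linarith

theorem card_dart_mul_log_le_sum_log_card_next [Nonempty V] (hdeg : ∀ v, 2 ≤ G.degree v) :
    Fintype.card G.Dart * Real.log (Fintype.card G.Dart / Fintype.card V - 1)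
      ≤ ∑ e : G.Dart, Real.log #e.next := by
  have hn : (0 : ℝ) < Fintype.card V := by exact_mod_cast Fintype.card_pos
  have h1 : ∑ e : G.Dart, Real.log #e.next
      = ∑ v, (G.degree v : ℝ) * Real.log (G.degree v - 1) := by
    rw [← sum_dart_snd fun v ↦ Real.log (G.degree v - 1)]
    refine sum_congr rfl fun e _ ↦ ?_
    rw [← e.card_next_add_one]
    simp
  have h2 := convexOn_mul_log_sub_one.map_sum_le (t := univ)
    (w := fun _ : V ↦ (Fintype.card V : ℝ)⁻¹) (p := fun v ↦ (G.degree v : ℝ))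
    (fun _ _ ↦ by positivity) (by simp [hn.ne']) (fun v _ ↦ by
      simpa using (by exact_mod_cast hdeg v : (2 : ℝ) ≤ G.degree v))
  simp only [smul_eq_mul, ← mul_sum] at h2
  rw [← h1, ← Nat.cast_sum, ← dart_card_eq_sum_degrees, ← div_eq_inv_mul, ← div_eq_inv_mul,
    div_mul_eq_mul_div, div_le_div_iff_of_pos_right hn] at h2
  exact h2

theorem card_dart_mul_pow_le_sum_nonbacktrackingCount [Nonempty V]
    (hdeg : ∀ v, 2 ≤ G.degree v) (k : ℕ) :
    Fintype.card G.Dart * ((Fintype.card G.Dart : ℝ) / Fintype.card V - 1) ^ k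
      ≤ ∑ e : G.Dart, (e.nonbacktrackingCount k : ℝ) := by
  have hn : (0 : ℝ) < Fintype.card V := by exact_mod_cast Fintype.card_pos
  have hmn : 2 * Fintype.card V ≤ Fintype.card G.Dart := by
    rw [dart_card_eq_sum_degrees, mul_comm, ← smul_eq_mul, ← card_univ, ← sum_const]
    exact sum_le_sum fun v _ ↦ hdeg v
  have hmn' : (2 : ℝ) ≤ Fintype.card G.Dart / Fintype.card V := by
    rw [le_div_iff₀ hn]
    exact_mod_cast hmn
  have hM : 0 < Fintype.card G.Dart := by
    have := Fintype.card_pos (α := V)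
    omega
  have hM' : (0 : ℝ) < Fintype.card G.Dart := by exact_mod_cast hM
  have : Nonempty G.Dart := Fintype.card_pos_iff.1 hM
  have hpos : ∀ e ∈ (univ : Finset G.Dart), (0 : ℝ) < e.nonbacktrackingCount k :=
    fun e _ ↦ by exact_mod_cast nonbacktrackingCount_pos hdeg k e
  have h1 := Real.sum_log_div_card_le_log univ_nonempty hpos
  rw [card_univ] at h1
  have hS := sum_pos hpos univ_nonempty
  have hd : 0 < (Fintype.card G.Dart : ℝ) / Fintype.card V - 1 := by linarith
  rw [mul_comm, ← le_div_iff₀ hM', ← Real.log_le_log_iff (by positivity) (by positivity),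
    Real.log_pow]
  refine le_trans ?_ h1
  rw [le_div_iff₀ hM']
  have h2 := mul_le_mul_of_nonneg_left (card_dart_mul_log_le_sum_log_card_next hdeg)
    (Nat.cast_nonneg (α := ℝ) k)
  linarith [mul_sum_log_card_next_le hdeg k]

/-- The irregular Moore bound under the assumption that there are no vertices of degree
less than two. -/
theorem moore_bound_of_two_le_degree [Nonempty V] {r : ℕ}
    (hr : ((2 * r + 1 : ℕ) : ℕ∞) ≤ G.egirth) (hdeg : ∀ v, 2 ≤ G.degree v) {d : ℝ}
    (hd : d = 2 * (#G.edgeFinset : ℝ) / Fintype.card V) :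
    1 + ∑ k ∈ range r, d * (d - 1) ^ k ≤ Fintype.card V := by
  have hn : (0 : ℝ) < Fintype.card V := by exact_mod_cast Fintype.card_pos
  have hM : (Fintype.card G.Dart : ℝ) = 2 * #G.edgeFinset := by
    exact_mod_cast G.dart_card_eq_twice_card_edges
  rw [← hM] at hd
  have h1 := sum_le_sum fun v (_ : v ∈ univ) ↦ one_add_sum_nonbacktrackingCount_le_card hr v
  rw [sum_add_distrib, sum_comm] at h1
  simp_rw [sum_fiberwise] at h1
  simp only [sum_const, card_univ, smul_eq_mul, mul_one] at h1
  have h2 : (Fintype.card V : ℝ)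
      + ∑ k ∈ range r, ∑ e : G.Dart, (e.nonbacktrackingCount k : ℝ)
        ≤ Fintype.card V * Fintype.card V := by
    exact_mod_cast h1
  have h3 := sum_le_sum fun k (_ : k ∈ range r) ↦
    card_dart_mul_pow_le_sum_nonbacktrackingCount hdeg k
  rw [← hd] at h3
  have hnd : (Fintype.card G.Dart : ℝ) = Fintype.card V * d := by
    rw [hd, mul_div_cancel₀ _ hn.ne']
  simp_rw [hnd, mul_assoc, ← mul_sum] at h3
  refine le_of_mul_le_mul_left ?_ hn
  rw [mul_add, mul_one, ← mul_sum]
  linarith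

theorem card_edgeFinset_induce_compl_singleton_add_degree (G : SimpleGraph V)
    [DecidableRel G.Adj] (v : V) :
    #(G.induce {v}ᶜ).edgeFinset + G.degree v = #G.edgeFinset := by
  rw [card_edgeFinset_induce_compl_singleton, card_edgeFinset_deleteIncidenceSet]
  exact Nat.sub_add_cancel (G.degree_le_card_edgeFinset v)

theorem moore_bound_of_card_le_card_edgeFinset (n : ℕ) {V : Type*} [Fintype V] [DecidableEq V]
    [Nonempty V] (G : SimpleGraph V) [DecidableRel G.Adj] {r : ℕ}
    (hr : ((2 * r + 1 : ℕ) : ℕ∞) ≤ G.egirth) (hn : Fintype.card V = n)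
    (hm : n ≤ #G.edgeFinset) {d : ℝ} (hd : d = 2 * (#G.edgeFinset : ℝ) / n) :
    1 + ∑ k ∈ range r, d * (d - 1) ^ k ≤ n := by
  induction n generalizing V d with
  | zero => exact absurd hn Fintype.card_ne_zero
  | succ n ih =>
    by_cases hdeg : ∀ v, 2 ≤ G.degree v
    · rw [← hn] at hd ⊢
      exact moore_bound_of_two_le_degree hr hdeg hd
    push Not at hdeg
    obtain ⟨v, hv⟩ := hdeg
    have hedge := G.card_edgeFinset_induce_compl_singleton_add_degree v
    set m := #(G.induce {v}ᶜ).edgeFinset with hm'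
    have hcard : Fintype.card ({v}ᶜ : Set V) = n := by
      rw [Fintype.card_compl_set, hn]
      simp
    have hnm : n ≤ m := by omega
    have hn0 : 0 < n := by
      by_contra! h0
      have h1 := G.card_edgeFinset_le_card_choose_two
      rw [hn, Nat.le_zero.1 h0] at h1
      have : (0 + 1).choose 2 = 0 := rfl
      omega
    have : Nonempty ({v}ᶜ : Set V) := Fintype.card_pos_iff.1 (hcard ▸ hn0)
    have hgirth : ((2 * r + 1 : ℕ) : ℕ∞) ≤ (G.induce {v}ᶜ).egirth :=
      hr.trans (IsContained.egirth_le ⟨Copy.induce G {v}ᶜ⟩)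
    have h := ih (G.induce {v}ᶜ) hgirth hcard hnm rfl
    rw [← hm'] at h
    have hn0' : (0 : ℝ) < n := by exact_mod_cast hn0
    have hd1 : 1 ≤ d := by
      rw [hd, le_div_iff₀ (by positivity)]
      exact_mod_cast (by omega)
    have hdd : d ≤ 2 * (m : ℝ) / n := by
      rw [hd, div_le_div_iff₀ (by positivity) hn0']
      have : #G.edgeFinset * n ≤ m * (n + 1) := by nlinarith
      have : (#G.edgeFinset * n : ℝ) ≤ m * (n + 1) := by exact_mod_cast this
      push_cast
      linarith
    calc 1 + ∑ k ∈ range r, d * (d - 1) ^ k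
        ≤ 1 + ∑ k ∈ range r, 2 * (m : ℝ) / n * (2 * (m : ℝ) / n - 1) ^ k := by
          gcongr
      _ ≤ n := h
      _ ≤ (n + 1 : ℕ) := by simp

end SimpleGraph

theorem stmt18 {V : Type*} [Fintype V] [DecidableEq V] [Nonempty V]
    (G : SimpleGraph V) [DecidableRel G.Adj] (r : ℕ)
    (hg : (2 * r + 1 : ℕ) ≤ G.girth) (d : ℝ)
    (hd : d = 2 * (G.edgeFinset.card : ℝ) / (Fintype.card V : ℝ)) (hd2 : 2 ≤ d) :
    1 + ∑ k ∈ Finset.range r, d * (d - 1) ^ k ≤ (Fintype.card V : ℝ) := by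
  refine G.moore_bound_of_card_le_card_edgeFinset _ ?_ rfl ?_ hd
  · exact (Nat.cast_le.2 hg).trans G.egirth.natCast_toNat_le_self
  · have hn : (0 : ℝ) < Fintype.card V := by exact_mod_cast Fintype.card_pos
    rw [hd, le_div_iff₀ hn, mul_le_mul_iff_right₀ two_pos] at hd2
    exact_mod_cast hd2
end
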